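/- For every integer n ≥ 1, the abelian complexity of the 4-bonacci word q satisfies ρ_q(n) = 6 if and only if n ∈ {3, 6, 12}; in particular, the value 6 is attained by ρ_q only finitely many times. -/

import Mathlib

/-- The m-bonacci substitution on letters. -/
def mbSub (m : ℕ) (ℓ : ℕ) : List ℕ :=
  if ℓ = m - 1 then [0] else [0, ℓ + 1]

/-- Application of the m-bonacci substitution to a word. -/
def mbApply (m : ℕ) (w : List ℕ) : List ℕ := w.flatMap (mbSub m)

/-- σ_m^k(0). -/
def mbIter (m k : ℕ) : List ℕ := (mbApply m)^[k] [0]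

/-- w is a factor of the m-bonacci word. -/
def mbFactor (m : ℕ) (w : List ℕ) : Prop := ∃ k, w <:+: mbIter m k

/-- The prefix of length n of the m-bonacci word. -/
def mbPrefix (m n : ℕ) : List ℕ := (mbIter m n).take n

/-- Abelian complexity: number of distinct Parikh vectors of factors of length n. -/
noncomputable def mbAC (m n : ℕ) : ℕ :=
  Set.ncard ((fun (w : List ℕ) (ℓ : ℕ) => w.count ℓ) ''
    {w : List ℕ | mbFactor m w ∧ w.length = n})

/-- Tribonacci numbers. -/
def tribN : ℕ → ℕ
  | 0 => 0
  | 1 => 0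
  | 2 => 1
  | n + 3 => tribN (n + 2) + tribN (n + 1) + tribN n

/-- Value of a digit string (most significant digit first) in the Tribonacci system. -/
def valT : List ℕ → ℕ
  | [] => 0
  | d :: rest => d * tribN (rest.length + 3) + valT rest

/-- L is the normal T-representation of n (MSB first, greedy). -/
def IsNormalTRep (n : ℕ) (L : List ℕ) : Prop :=
  (∀ d ∈ L, d ≤ 1) ∧ (∀ d ∈ L.take 1, d = 1) ∧ valT L = n ∧
    ∀ S, S <:+ L → valT S < tribN (S.length + 3)

/-- Value of a digit string (MSB first) in the m-bonacci numeration system U_j = |σ_m^j(0)|. -/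
def valU (m : ℕ) : List ℕ → ℕ
  | [] => 0
  | d :: rest => d * (mbIter m rest.length).length + valU m rest

/-- L is the normal U-representation of n (MSB first, greedy) in the m-bonacci system. -/
def IsNormalURep (m n : ℕ) (L : List ℕ) : Prop :=
  (∀ d ∈ L, d ≤ 1) ∧ (∀ d ∈ L.take 1, d = 1) ∧ valU m L = n ∧
    ∀ S, S <:+ L → valU m S < (mbIter m S.length).length

/-- Integer vectors indexed by the four letters. -/
abbrev Vec4 := ℤ × ℤ × ℤ × ℤ

/-- The sum of the coordinates. -/
def Vec4.total (x : Vec4) : ℤ := x.1 + x.2.1 + x.2.2.1 + x.2.2.2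

/-- The incidence matrix of the 4-bonacci substitution applied to `x`, with `d` more letters `0`. -/
def Vec4.shift (x : Vec4) (d : ℤ) : Vec4 := (x.total + d, x.1, x.2.1, x.2.2.1)

/-- A vector which no sequence of shifts by `d ∈ [-2, 1]` takes to a vector of total `0`. -/
def Vec4.Diverges (x : Vec4) : Prop :=
  (3 ≤ x.total ∧ 5 ≤ (x.shift 0).total ∧ 9 ≤ ((x.shift 0).shift 0).total ∧
    17 ≤ (((x.shift 0).shift 0).shift 0).total) ∨
  (x.total ≤ -2 ∧ (x.shift 0).total ≤ -3 ∧ ((x.shift 0).shift 0).total ≤ -5 ∧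
    (((x.shift 0).shift 0).shift 0).total ≤ -9)

theorem Vec4.Diverges.shift {x : Vec4} (h : x.Diverges) {d : ℤ} (h₁ : -2 ≤ d) (h₂ : d ≤ 1) :
    (x.shift d).Diverges := by
  simp only [Vec4.Diverges, Vec4.shift, Vec4.total] at *
  omega

theorem Vec4.Diverges.total_ne_zero {x : Vec4} (h : x.Diverges) : x.total ≠ 0 := by
  simp only [Vec4.Diverges] at h
  omega

theorem Vec4.shift_sub_shift (x y : Vec4) (d e : ℤ) :
    x.shift d - y.shift e = (x - y).shift (d - e) := by
  simp only [Vec4.shift, Vec4.total, Prod.mk_sub_mk, Prod.fst_sub, Prod.snd_sub, Prod.mk.injEq,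
    and_true]
  ring

theorem Vec4.shift_add_shift (x y : Vec4) (d e : ℤ) :
    x.shift d + y.shift e = (x + y).shift (d + e) := by
  simp only [Vec4.shift, Vec4.total, Prod.mk_add_mk, Prod.fst_add, Prod.snd_add, Prod.mk.injEq,
    and_true]
  ring

theorem Vec4.zero_shift_zero : (0 : Vec4).shift 0 = 0 := rfl

theorem Vec4.total_sub (x y : Vec4) : (x - y).total = x.total - y.total := by
  simp only [Vec4.total, Prod.fst_sub, Prod.snd_sub]
  ring

theorem Vec4.total_add (x y : Vec4) : (x + y).total = x.total + y.total := by
  simp only [Vec4.total, Prod.fst_add, Prod.snd_add]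
  ring

/-- `PrefixVec k v a`: in `σ₄ᵏ(0)` some prefix with Parikh vector `v` is followed by the
letter `a`. -/
inductive PrefixVec : ℕ → Vec4 → ℕ → Prop
  | zero : PrefixVec 0 0 0
  | first {k v a} : PrefixVec k v a → PrefixVec (k + 1) (v.shift 0) 0
  | second {k v a} : PrefixVec k v a → a < 3 → PrefixVec (k + 1) (v.shift 1) (a + 1)

theorem PrefixVec.succ {k : ℕ} {v : Vec4} {a : ℕ} (h : PrefixVec k v a) :
    PrefixVec (k + 1) v a := by
  induction h with
  | zero => exact PrefixVec.first .zero
  | first _ ih => exact ih.first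
  | second _ ha ih => exact ih.second ha

theorem PrefixVec.mono {k l : ℕ} {v : Vec4} {a : ℕ} (h : PrefixVec k v a) (hkl : k ≤ l) :
    PrefixVec l v a := by
  induction hkl with
  | refl => exact h
  | step _ ih => exact ih.succ

/-- The digits in `{-1, 0, 1}` allowed after a signed run `r` of equal nonzero digits, each with the
new signed run: neither `1` nor `-1` may occur four times in a row. -/
def signedDigits (r : ℤ) : List (ℤ × ℤ) :=
  (0, 0) :: ((if r < 3 then [(1, max r 0 + 1)] else []) ++
    (if -3 < r then [(-1, min r 0 - 1)] else []))

theorem mem_signedDigits {r : ℤ} {m : ℤ × ℤ} : m ∈ signedDigits r ↔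
    m = (0, 0) ∨ (r < 3 ∧ m = (1, max r 0 + 1)) ∨ (-3 < r ∧ m = (-1, min r 0 - 1)) := by
  unfold signedDigits
  split_ifs <;> simp [*]

theorem signedDigits_bounds {r : ℤ} {m : ℤ × ℤ} (h : m ∈ signedDigits r) :
    -1 ≤ m.1 ∧ m.1 ≤ 1 := by
  rcases mem_signedDigits.1 h with rfl | ⟨-, rfl⟩ | ⟨-, rfl⟩ <;> simp

/-- The vectors with a signed expansion of `k` digits, with the signed run at its end. -/
inductive SignedVec : ℕ → Vec4 → ℤ → Prop
  | zero : SignedVec 0 0 0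
  | step {k y r m} : SignedVec k y r → m ∈ signedDigits r → SignedVec (k + 1) (y.shift m.1) m.2

theorem SignedVec.exists_prefixVec {k : ℕ} {y : Vec4} {r : ℤ} (h : SignedVec k y r) :
    ∃ v w, PrefixVec k v (-r).toNat ∧ PrefixVec k w r.toNat ∧ y = w - v := by
  induction h with
  | zero => exact ⟨0, 0, .zero, .zero, by simp⟩
  | @step k y r m _ hm ih =>
    obtain ⟨v, w, hv, hw, rfl⟩ := ih
    rcases mem_signedDigits.1 hm with rfl | ⟨hr, rfl⟩ | ⟨hr, rfl⟩
    · exact ⟨_, _, hv.first, hw.first, by simp [Vec4.shift_sub_shift]⟩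
    · refine ⟨v.shift 0, w.shift 1, ?_, ?_, by simp [Vec4.shift_sub_shift]⟩
      · convert hv.first using 1
        simp only
        omega
      · convert hw.second (by omega) using 1
        simp only
        omega
    · refine ⟨v.shift 1, w.shift 0, ?_, ?_, by simp [Vec4.shift_sub_shift]⟩
      · convert hv.second (by omega) using 1
        simp only
        omega
      · convert hw.first using 1
        simp only
        omega

theorem PrefixVec.exists_signedVec {k : ℕ} {v w : Vec4} {a b : ℕ} (hv : PrefixVec k v a)
    (hw : PrefixVec k w b) : ∃ r : ℤ, SignedVec k (w - v) r ∧ -a ≤ r ∧ r ≤ b := by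
  induction k generalizing v w a b with
  | zero =>
    cases hv
    cases hw
    exact ⟨0, by simpa using SignedVec.zero, by simp, by simp⟩
  | succ k ih =>
    cases hv with
    | first hv =>
      cases hw with
      | first hw =>
        obtain ⟨r, h, -, -⟩ := ih hv hw
        refine ⟨0, ?_, by simp, by simp⟩
        rw [Vec4.shift_sub_shift]
        exact h.step (m := (0, 0)) (mem_signedDigits.2 (.inl rfl))
      | second hw hb =>
        obtain ⟨r, h, h₁, h₂⟩ := ih hv hw
        refine ⟨max r 0 + 1, ?_, by omega, by push_cast; omega⟩
        rw [Vec4.shift_sub_shift]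
        exact h.step (m := (1, max r 0 + 1)) (mem_signedDigits.2 (.inr (.inl ⟨by omega, rfl⟩)))
    | second hv ha =>
      cases hw with
      | first hw =>
        obtain ⟨r, h, h₁, h₂⟩ := ih hv hw
        refine ⟨min r 0 - 1, ?_, by push_cast; omega, by omega⟩
        rw [Vec4.shift_sub_shift]
        exact h.step (m := (-1, min r 0 - 1)) (mem_signedDigits.2 (.inr (.inr ⟨by omega, rfl⟩)))
      | second hw hb =>
        obtain ⟨r, h, -, -⟩ := ih hv hw
        refine ⟨0, ?_, by push_cast; omega, by push_cast; omega⟩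
        rw [Vec4.shift_sub_shift]
        exact h.step (m := (0, 0)) (mem_signedDigits.2 (.inl rfl))

/-- The Parikh vector of a word on the letters `0, 1, 2, 3`. -/
def parikh (w : List ℕ) : Vec4 := (w.count 0, w.count 1, w.count 2, w.count 3)

theorem parikh_append (u w : List ℕ) : parikh (u ++ w) = parikh u + parikh w := by
  simp [parikh]

theorem total_parikh {w : List ℕ} (hw : ∀ a ∈ w, a < 4) : (parikh w).total = w.length := by
  induction w with
  | nil => simp [parikh, Vec4.total]
  | cons a w ih =>
    have h := ih fun b hb => hw b (List.mem_cons_of_mem _ hb)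
    have ha : a < 4 := hw a List.mem_cons_self
    simp only [parikh, Vec4.total] at h ⊢
    interval_cases a <;> simp <;> omega

theorem mbApply_append (m : ℕ) (u w : List ℕ) :
    mbApply m (u ++ w) = mbApply m u ++ mbApply m w := by
  simp [mbApply]

theorem mbApply_cons (m a : ℕ) (w : List ℕ) : mbApply m (a :: w) = mbSub m a ++ mbApply m w := by
  simp [mbApply]

theorem parikh_mbApply {w : List ℕ} (hw : ∀ a ∈ w, a < 4) :
    parikh (mbApply 4 w) = (parikh w).shift 0 := by
  induction w with
  | nil => simp [parikh, Vec4.total, Vec4.shift, mbApply]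
  | cons a w ih =>
    have h := ih fun b hb => hw b (List.mem_cons_of_mem _ hb)
    have ha : a < 4 := hw a List.mem_cons_self
    rw [mbApply_cons, parikh_append, h]
    interval_cases a <;> simp [parikh, Vec4.shift, Vec4.total, mbSub] <;> grind

theorem mbIter_succ (m k : ℕ) : mbIter m (k + 1) = mbApply m (mbIter m k) :=
  Function.iterate_succ_apply' ..

theorem mbIter_lt {k a : ℕ} (h : a ∈ mbIter 4 k) : a < 4 := by
  induction k generalizing a with
  | zero =>
    simp [mbIter] at h
    omega
  | succ k ih =>
    rw [mbIter_succ, mbApply, List.mem_flatMap] at h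
    obtain ⟨b, hb, hab⟩ := h
    have := ih hb
    unfold mbSub at hab
    split_ifs at hab <;> simp at hab <;> omega

theorem mbIter_succ_eq_append (k : ℕ) : ∃ t, t ≠ [] ∧ mbIter 4 (k + 1) = mbIter 4 k ++ t := by
  induction k with
  | zero => exact ⟨[1], by simp, by decide⟩
  | succ k ih =>
    obtain ⟨t, ht, h⟩ := ih
    refine ⟨mbApply 4 t, ?_, by rw [mbIter_succ, h, mbApply_append, ← mbIter_succ, h]⟩
    cases t with
    | nil => exact absurd rfl ht
    | cons a t =>
      rw [mbApply_cons]
      unfold mbSub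
      split_ifs <;> simp

theorem lt_length_mbIter (k : ℕ) : k < (mbIter 4 k).length := by
  induction k with
  | zero => decide
  | succ k ih =>
    obtain ⟨t, ht, h⟩ := mbIter_succ_eq_append k
    have := List.length_pos_iff.2 ht
    rw [h, List.length_append]
    omega

theorem mbApply_eq_append_cons {w u t : List ℕ} {a : ℕ} (h : mbApply 4 w = u ++ a :: t) :
    ∃ u₀ b t₀, w = u₀ ++ b :: t₀ ∧ ((u = mbApply 4 u₀ ∧ a = 0) ∨
      (b ≠ 3 ∧ u = mbApply 4 u₀ ++ [0] ∧ a = b + 1)) := by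
  induction w generalizing u with
  | nil => simp [mbApply] at h
  | cons c w ih =>
    have shifted {u' : List ℕ} (h' : mbApply 4 w = u' ++ a :: t) (hu : u = mbSub 4 c ++ u') :
        ∃ u₀ b t₀, c :: w = u₀ ++ b :: t₀ ∧ ((u = mbApply 4 u₀ ∧ a = 0) ∨
          (b ≠ 3 ∧ u = mbApply 4 u₀ ++ [0] ∧ a = b + 1)) := by
      obtain ⟨u₀, b, t₀, rfl, h₀⟩ := ih h'
      refine ⟨c :: u₀, b, t₀, rfl, ?_⟩
      simpa [hu, mbApply_cons] using h₀
    rw [mbApply_cons] at h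
    by_cases hc : c = 3
    · rw [show mbSub 4 c = [0] by simp [mbSub, hc]] at h shifted
      rcases u with - | ⟨x, u⟩
      · simp only [List.cons_append, List.nil_append, List.cons.injEq] at h
        exact ⟨[], c, w, rfl, .inl ⟨by simp [mbApply], h.1.symm⟩⟩
      · simp only [List.cons_append, List.nil_append, List.cons.injEq] at h
        exact shifted h.2 (by simp [h.1])
    · rw [show mbSub 4 c = [0, c + 1] by simp [mbSub, hc]] at h shifted
      rcases u with - | ⟨x, - | ⟨y, u⟩⟩
      · simp only [List.cons_append, List.nil_append, List.cons.injEq] at h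
        exact ⟨[], c, w, rfl, .inl ⟨by simp [mbApply], h.1.symm⟩⟩
      · simp only [List.cons_append, List.nil_append, List.cons.injEq] at h
        exact ⟨[], c, w, rfl, .inr ⟨hc, by simp [mbApply, h.1], h.2.1.symm⟩⟩
      · simp only [List.cons_append, List.nil_append, List.cons.injEq] at h
        exact shifted h.2.2 (by simp [h.1, h.2.1])

theorem prefixVec_of_mbIter {k a : ℕ} {u t : List ℕ} (h : mbIter 4 k = u ++ a :: t) :
    PrefixVec k (parikh u) a := by
  induction k generalizing u a t with
  | zero =>
    rcases u with - | ⟨x, u⟩ <;> simp [mbIter] at h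
    rw [← h.1]
    exact .zero
  | succ k ih =>
    rw [mbIter_succ] at h
    obtain ⟨u₀, b, t₀, h₀, h₁⟩ := mbApply_eq_append_cons h
    have hlt : ∀ c ∈ u₀ ++ b :: t₀, c < 4 := fun c hc => mbIter_lt (h₀ ▸ hc)
    have hu₀ : ∀ c ∈ u₀, c < 4 := fun c hc => hlt c (by simp [hc])
    have hb : b < 4 := hlt b (by simp)
    rcases h₁ with ⟨rfl, rfl⟩ | ⟨hb₃, rfl, rfl⟩
    · rw [parikh_mbApply hu₀]
      exact (ih h₀).first
    · rw [parikh_append, parikh_mbApply hu₀]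
      convert (ih h₀).second (by omega) using 1
      simp [parikh, Vec4.shift]

theorem PrefixVec.exists_mbIter {k a : ℕ} {v : Vec4} (h : PrefixVec k v a) :
    ∃ u t, mbIter 4 k = u ++ a :: t ∧ parikh u = v := by
  induction h with
  | zero => exact ⟨[], [], rfl, by simp [parikh]⟩
  | @first k v a _ ih =>
    obtain ⟨u, t, h, rfl⟩ := ih
    have hu : ∀ c ∈ u, c < 4 := fun c hc => mbIter_lt (k := k) (by simp [h, hc])
    obtain ⟨s, hs⟩ : ∃ s, mbSub 4 a = 0 :: s := by
      unfold mbSub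
      split_ifs <;> simp
    exact ⟨mbApply 4 u, s ++ mbApply 4 t,
      by simp [mbIter_succ, h, mbApply_append, mbApply_cons, hs], parikh_mbApply hu⟩
  | @second k v a _ ha ih =>
    obtain ⟨u, t, h, rfl⟩ := ih
    have hu : ∀ c ∈ u, c < 4 := fun c hc => mbIter_lt (k := k) (by simp [h, hc])
    have hs : mbSub 4 a = [0, a + 1] := by simp [mbSub, ha.ne]
    refine ⟨mbApply 4 u ++ [0], mbApply 4 t,
      by simp [mbIter_succ, h, mbApply_append, mbApply_cons, hs], ?_⟩
    rw [parikh_append, parikh_mbApply hu]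
    simp [parikh, Vec4.shift]

/-- The vectors of total `n` with a signed expansion. -/
def signedVecs (n : ℕ) : Set Vec4 := {y | y.total = n ∧ ∃ k r, SignedVec k y r}

theorem image_parikh_eq_signedVecs (n : ℕ) :
    parikh '' {w : List ℕ | mbFactor 4 w ∧ w.length = n} = signedVecs n := by
  ext y
  constructor
  · rintro ⟨w, ⟨⟨k, s, t, h⟩, rfl⟩, rfl⟩
    obtain ⟨t', ht', hk⟩ := mbIter_succ_eq_append k
    have hlt : ∀ a ∈ w, a < 4 := fun a ha => mbIter_lt (k := k) (by simp [← h, ha])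
    refine ⟨total_parikh hlt, k + 1, ?_⟩
    obtain ⟨a, l, ha⟩ := List.exists_cons_of_ne_nil
      (show w ++ (t ++ t') ≠ [] by simp [ht'])
    obtain ⟨b, l', hb⟩ := List.exists_cons_of_ne_nil (show t ++ t' ≠ [] by simp [ht'])
    have h₁ : mbIter 4 (k + 1) = s ++ a :: l := by rw [hk, ← h, ← ha]; simp
    have h₂ : mbIter 4 (k + 1) = (s ++ w) ++ b :: l' := by rw [hk, ← h, ← hb]; simp
    obtain ⟨r, hr, -⟩ := (prefixVec_of_mbIter h₁).exists_signedVec (prefixVec_of_mbIter h₂)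
    exact ⟨r, by simpa [parikh_append] using hr⟩
  · rintro ⟨hn, k, r, h⟩
    obtain ⟨v, w, hv, hw, rfl⟩ := h.exists_prefixVec
    obtain ⟨u, t, hu, rfl⟩ := hv.exists_mbIter
    obtain ⟨u', t', hu', rfl⟩ := hw.exists_mbIter
    have hlt : ∀ a ∈ u, a < 4 := fun a ha => mbIter_lt (k := k) (by simp [hu, ha])
    have hlt' : ∀ a ∈ u', a < 4 := fun a ha => mbIter_lt (k := k) (by simp [hu', ha])
    rw [Vec4.total_sub, total_parikh hlt, total_parikh hlt'] at hn
    obtain ⟨z, rfl⟩ := List.prefix_of_prefix_length_le (l₁ := u) (l₂ := u')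
      ⟨_, hu.symm⟩ ⟨_, hu'.symm⟩ (by omega)
    refine ⟨z, ⟨⟨k, u, _, hu'.symm⟩, ?_⟩, by simp [parikh_append]⟩
    rw [List.length_append] at hn
    omega

theorem mbAC_eq_ncard_signedVecs (n : ℕ) : mbAC 4 n = (signedVecs n).ncard := by
  rw [← image_parikh_eq_signedVecs, mbAC]
  let proj : (ℕ → ℕ) → Vec4 := fun f => (f 0, f 1, f 2, f 3)
  rw [← Set.InjOn.ncard_image (f := proj), Set.image_image]
  · rfl
  · rintro _ ⟨w, ⟨⟨k, hw⟩, -⟩, rfl⟩ _ ⟨w', ⟨⟨k', hw'⟩, -⟩, rfl⟩ h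
    simp only [proj, Prod.mk.injEq, Nat.cast_inj] at h
    funext a
    by_cases ha : a < 4
    · interval_cases a <;> tauto
    · have h₁ : a ∉ w := fun hm => ha (mbIter_lt (hw.subset hm))
      have h₂ : a ∉ w' := fun hm => ha (mbIter_lt (hw'.subset hm))
      simp [List.count_eq_zero_of_not_mem, h₁, h₂]

/-- The shape of a binary expansion without four consecutive ones. -/
inductive Shape
  /-- no nonzero digit -/
  | zero
  /-- `1` followed by `p` zeros -/
  | single (p : ℕ)
  /-- at least two ones, with exactly three zeros between consecutive ones, then `p` zeros -/
  | periodic (p : ℕ)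
  /-- `11` followed by `p` zeros -/
  | double (p : ℕ)
  /-- anything else, ending in exactly `r` ones -/
  | generic (r : ℕ)
  deriving DecidableEq

/-- The shape after appending the digit `e`. -/
def Shape.next : Shape → ℕ → Shape
  | zero, 0 => zero
  | zero, _ => single 0
  | single p, 0 => if p < 3 then single (p + 1) else generic 0
  | single p, _ => if p = 0 then double 0 else if p = 3 then periodic 0 else generic 1
  | periodic p, 0 => if p < 3 then periodic (p + 1) else generic 0
  | periodic p, _ => if p = 0 then generic 2 else if p = 3 then periodic 0 else generic 1
  | double p, 0 => if p < 2 then double (p + 1) else generic 0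
  | double p, _ => if p = 0 then generic 3 else generic 1
  | generic _, 0 => generic 0
  | generic r, _ => generic (r + 1)

/-- The number of ones at the end of the expansion. -/
def Shape.run : Shape → ℕ
  | zero => 0
  | single p => if p = 0 then 1 else 0
  | periodic p => if p = 0 then 1 else 0
  | double p => if p = 0 then 2 else 0
  | generic r => r

/-- The shape of a word of digits, least significant digit first. -/
def wordShape : List ℕ → Shape
  | [] => .zero
  | e :: w => (wordShape w).next e

/-- Whether the expansion is generic. -/
def Shape.isGeneric : Shape → Bool
  | generic _ => true
  | _ => false

/-- Whether the expansion is `11` followed by zeros. -/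
def Shape.isDouble : Shape → Bool
  | double _ => true
  | _ => false

/-- The sum of the four coordinates of a code, each of which is stored with offset `5`. -/
def codeTotal (n : ℕ) : ℕ := n % 10 + n / 10 % 10 + n / 100 % 10 + n / 1000 % 10

/-- Whether a code is not known to diverge. -/
def codeKept (n : ℕ) : Bool :=
  let a := n % 10
  let b := n / 10 % 10
  let c := n / 100 % 10
  let d := n / 1000 % 10
  (Nat.ble (a + b + c + d) 22 || Nat.ble (2 * a + 2 * b + 2 * c + d) 39 ||
    Nat.ble (4 * a + 4 * b + 3 * c + 2 * d) 73 || Nat.ble (8 * a + 7 * b + 6 * c + 4 * d) 141) &&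
  (Nat.ble 19 (a + b + c + d) || Nat.ble 33 (2 * a + 2 * b + 2 * c + d) ||
    Nat.ble 61 (4 * a + 4 * b + 3 * c + 2 * d) || Nat.ble 117 (8 * a + 7 * b + 6 * c + 4 * d))

/-- Whether the total of a code is small enough for the coordinates after a shift to be digits. -/
def codeSmall (n : ℕ) : Bool := Nat.ble 18 (codeTotal n) && Nat.ble (codeTotal n) 23

/-- The code after the digit `δ - 1`, with signed run `r - 3`, where the reference expansion has
digit `e`. -/
def codeShift (e n δ r : ℕ) : ℕ :=
  codeTotal n + δ - (16 + e) + 10 * (n % 1000) + 10000 * r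

/-- The codes reached from a code in one digit. -/
def codeSteps (e n : ℕ) : List ℕ :=
  bif codeSmall n then
    codeShift e n 1 3 ::
      ((bif Nat.ble (n / 10000) 5 then [codeShift e n 2 (max (n / 10000) 3 + 1)] else []) ++
      (bif Nat.ble 1 (n / 10000) then [codeShift e n 0 (min (n / 10000) 3 - 1)] else []))
  else []

/-- Adds to the list `l`, whose elements are the positions of the ones of `m`, the missing elements
of a list. The cases `0` and `n + 1` are separate so that the kernel evaluates each element. -/
def insertCodes : List ℕ → ℕ → List ℕ → ℕ × List ℕ
  | [], m, l => (m, l)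
  | 0 :: t, m, l =>
    bif m.testBit 0 then insertCodes t m l else insertCodes t (m ||| 1 <<< 0) (0 :: l)
  | (n + 1) :: t, m, l =>
    bif m.testBit (n + 1) then insertCodes t m l
    else insertCodes t (m ||| 1 <<< (n + 1)) ((n + 1) :: l)

/-- The set of codes reached in one digit, as a bit mask and as a list. -/
def nextCodes (e : ℕ) (S : ℕ × List ℕ) : ℕ × List ℕ :=
  insertCodes ((S.2.flatMap (codeSteps e)).filter codeKept) 0 []

/-- The codes reached along a word of digits, least significant digit first, after sufficiently
many leading zeros. -/
def wordCodes : List ℕ → ℕ × List ℕ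
  | [] => (nextCodes 0)^[6] (0, [35555])
  | e :: w => nextCodes e (wordCodes w)

/-- The codes of total `0`, with the signed run removed. -/
def balancedCodes (S : List ℕ) : List ℕ :=
  (insertCodes ((S.filter fun n => Nat.beq (codeTotal n) 20).map fun n => n % 10000) 0 []).2

/-- Words of digits, least significant digit first, whose sets of codes represent those of all
words. -/
def minimalWords : List (List ℕ) :=
  [[], [1], [0, 1], [1, 1], [0, 0, 1], [1, 0, 1], [0, 1, 1], [1, 1, 1], [0, 0, 0, 1],
   [1, 0, 0, 1], [0, 1, 0, 1], [1, 1, 0, 1], [0, 0, 1, 1], [0, 1, 1, 1], [0, 0, 0, 0, 1],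
   [1, 0, 0, 0, 1], [0, 1, 0, 0, 1], [1, 1, 0, 0, 1], [0, 0, 1, 0, 1], [0, 1, 1, 0, 1],
   [0, 0, 0, 1, 1], [0, 0, 1, 1, 1], [0, 0, 0, 0, 0, 1], [1, 0, 0, 0, 0, 1], [0, 1, 0, 0, 0, 1],
   [1, 1, 0, 0, 0, 1], [0, 0, 1, 0, 0, 1], [0, 1, 1, 0, 0, 1], [0, 0, 0, 1, 0, 1],
   [0, 0, 1, 1, 0, 1], [1, 0, 0, 0, 1, 1], [1, 1, 0, 0, 0, 0, 1], [0, 0, 1, 0, 0, 0, 1],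
   [0, 1, 1, 0, 0, 0, 1], [0, 0, 0, 1, 0, 0, 1], [0, 0, 1, 1, 0, 0, 1], [1, 0, 0, 0, 1, 0, 1],
   [0, 1, 0, 0, 0, 1, 1], [0, 0, 0, 1, 0, 0, 0, 1], [0, 0, 1, 1, 0, 0, 0, 1],
   [1, 0, 0, 0, 1, 0, 0, 1], [0, 1, 0, 0, 0, 1, 0, 1], [0, 0, 1, 0, 0, 0, 1, 1],
   [0, 1, 0, 0, 0, 1, 0, 0, 1], [0, 0, 1, 0, 0, 0, 1, 0, 1], [0, 0, 1, 0, 0, 0, 1, 0, 0, 1],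
   [0, 0, 0, 1, 0, 0, 0, 1, 0, 1]]

/-- Whether the number of balanced codes of a word agrees with its shape. -/
def cardCheck (w : List ℕ) : Bool :=
  bif (wordShape w).isGeneric then Nat.ble 7 (balancedCodes (wordCodes w).2).length
  else (Nat.beq (balancedCodes (wordCodes w).2).length 6) == (wordShape w).isDouble

/-- Whether a minimal word represents the extension of `w` by the digit `e`. -/
def closedCheck (w : List ℕ) (e : ℕ) : Bool :=
  minimalWords.any fun u => decide (wordShape u = (wordShape w).next e) &&
    ((wordCodes u).1 &&& (wordCodes (e :: w)).1).beq (wordCodes u).1 &&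
    ((wordShape u).isGeneric || (wordCodes u).1.beq (wordCodes (e :: w)).1)

theorem minimalWords_check : minimalWords.all (fun w => cardCheck w &&
    (wordCodes w).2.all codeSmall && closedCheck w 0 &&
    (Nat.beq (wordShape w).run 3 || closedCheck w 1)) = true := by
  decide +kernel

theorem wordCodes_zero_check : (Nat.beq (wordCodes [0]).1 (wordCodes []).1 &&
    (wordCodes []).2.any (Nat.beq 35555)) = true := by
  decide +kernel

/-- The vector of a code. -/
def codeVec (n : ℕ) : Vec4 :=
  ((n % 10 : ℕ) - 5, (n / 10 % 10 : ℕ) - 5, (n / 100 % 10 : ℕ) - 5, (n / 1000 % 10 : ℕ) - 5)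

/-- The signed run of a code. -/
def codeRun (n : ℕ) : ℤ := (n / 10000 : ℕ) - 3

theorem total_codeVec (n : ℕ) : (codeVec n).total = codeTotal n - 20 := by
  simp only [Vec4.total, codeVec, codeTotal]
  omega

theorem codeVec_codeShift {e n δ : ℕ} (r : ℕ) (hn : codeSmall n = true) (he : e ≤ 1) (hδ : δ ≤ 2) :
    codeVec (codeShift e n δ r) = (codeVec n).shift (δ - 1 - e) := by
  simp only [codeSmall, Bool.and_eq_true, Nat.ble_eq] at hn
  rw [Vec4.shift, total_codeVec]
  simp only [codeVec, codeShift, Prod.mk.injEq]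
  generalize codeTotal n = T at *
  omega

theorem codeRun_codeShift {e n δ : ℕ} (r : ℕ) (hn : codeSmall n = true) (hδ : δ ≤ 2) :
    codeRun (codeShift e n δ r) = r - 3 := by
  simp only [codeSmall, Bool.and_eq_true, Nat.ble_eq] at hn
  simp only [codeRun, codeShift]
  generalize codeTotal n = T at *
  omega

theorem diverges_of_codeKept {n : ℕ} (h : codeKept n = false) : (codeVec n).Diverges := by
  rw [← Bool.not_eq_true] at h
  simp only [codeKept, Bool.and_eq_true, Bool.or_eq_true, Nat.ble_eq] at h
  simp only [Vec4.Diverges, Vec4.shift, Vec4.total, codeVec]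
  omega

theorem codeSmall_of_mem_codeSteps {e n n' : ℕ} (h : n' ∈ codeSteps e n) : codeSmall n = true := by
  unfold codeSteps at h
  cases hn : codeSmall n <;> simp_all

theorem mem_codeSteps {e n n' : ℕ} (hn : codeSmall n = true) : n' ∈ codeSteps e n ↔
    n' = codeShift e n 1 3 ∨
    (n / 10000 ≤ 5 ∧ n' = codeShift e n 2 (max (n / 10000) 3 + 1)) ∨
    (1 ≤ n / 10000 ∧ n' = codeShift e n 0 (min (n / 10000) 3 - 1)) := by
  rw [codeSteps, hn, cond_true, List.mem_cons, List.mem_append]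
  simp only [Bool.cond_eq_ite, Nat.ble_eq]
  split_ifs <;> simp [*]

theorem exists_signedDigit_of_mem_codeSteps {e n n' : ℕ} (he : e ≤ 1) (h : n' ∈ codeSteps e n) :
    ∃ m ∈ signedDigits (codeRun n),
      codeVec n' = (codeVec n).shift (m.1 - e) ∧ codeRun n' = m.2 := by
  have hn := codeSmall_of_mem_codeSteps h
  rcases (mem_codeSteps hn).1 h with rfl | ⟨hr, rfl⟩ | ⟨hr, rfl⟩
  · refine ⟨(0, 0), mem_signedDigits.2 (.inl rfl), ?_, ?_⟩
    · rw [codeVec_codeShift _ hn he (by omega)]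
      simp
    · rw [codeRun_codeShift _ hn (by omega)]
      simp
  · refine ⟨(1, max (codeRun n) 0 + 1), mem_signedDigits.2 (.inr (.inl ⟨?_, rfl⟩)), ?_, ?_⟩
    · simp only [codeRun]
      omega
    · rw [codeVec_codeShift _ hn he (by omega)]
      simp
    · rw [codeRun_codeShift _ hn (by omega)]
      simp only [codeRun]
      omega
  · refine ⟨(-1, min (codeRun n) 0 - 1), mem_signedDigits.2 (.inr (.inr ⟨?_, rfl⟩)), ?_, ?_⟩
    · simp only [codeRun]
      omega
    · rw [codeVec_codeShift _ hn he (by omega)]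
      simp
    · rw [codeRun_codeShift _ hn (by omega)]
      simp only [codeRun]
      omega

theorem exists_mem_codeSteps {e n : ℕ} (he : e ≤ 1) (hn : codeSmall n = true) {m : ℤ × ℤ}
    (hm : m ∈ signedDigits (codeRun n)) :
    ∃ n' ∈ codeSteps e n, codeVec n' = (codeVec n).shift (m.1 - e) ∧ codeRun n' = m.2 := by
  rcases mem_signedDigits.1 hm with rfl | ⟨hr, rfl⟩ | ⟨hr, rfl⟩
  · refine ⟨_, (mem_codeSteps hn).2 (.inl rfl), ?_, ?_⟩
    · rw [codeVec_codeShift _ hn he (by omega)]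
      simp
    · rw [codeRun_codeShift _ hn (by omega)]
      simp
  · simp only [codeRun] at hr
    refine ⟨_, (mem_codeSteps hn).2 (.inr (.inl ⟨by omega, rfl⟩)), ?_, ?_⟩
    · rw [codeVec_codeShift _ hn he (by omega)]
      simp
    · rw [codeRun_codeShift _ hn (by omega)]
      simp only [codeRun]
      omega
  · simp only [codeRun] at hr
    refine ⟨_, (mem_codeSteps hn).2 (.inr (.inr ⟨by omega, rfl⟩)), ?_, ?_⟩
    · rw [codeVec_codeShift _ hn he (by omega)]
      simp
    · rw [codeRun_codeShift _ hn (by omega)]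
      simp only [codeRun]
      omega

theorem insertCodes_cons (n : ℕ) (t : List ℕ) (m : ℕ) (l : List ℕ) :
    insertCodes (n :: t) m l =
      if m.testBit n then insertCodes t m l else insertCodes t (m ||| 1 <<< n) (n :: l) := by
  cases n <;> simp [insertCodes, Bool.cond_eq_ite]

theorem insertCodes_spec (t : List ℕ) {m : ℕ} {l : List ℕ} (h : ∀ k, m.testBit k ↔ k ∈ l)
    (hl : l.Nodup) :
    (∀ k, (insertCodes t m l).1.testBit k ↔ k ∈ (insertCodes t m l).2) ∧
    (∀ k, k ∈ (insertCodes t m l).2 ↔ k ∈ l ∨ k ∈ t) ∧ (insertCodes t m l).2.Nodup := by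
  induction t generalizing m l with
  | nil => simp [insertCodes, h, hl]
  | cons n t ih =>
    rw [insertCodes_cons]
    split_ifs with hn
    · obtain ⟨h₁, h₂, h₃⟩ := ih h hl
      refine ⟨h₁, fun k => ?_, h₃⟩
      have := (h n).1 hn
      rw [h₂]
      grind
    · have h' : ∀ k, (m ||| 1 <<< n).testBit k ↔ k ∈ n :: l := fun k => by
        rw [Nat.testBit_or, Bool.or_eq_true, h, Nat.one_shiftLeft, Nat.testBit_two_pow,
          decide_eq_true_iff, List.mem_cons]
        tauto
      obtain ⟨h₁, h₂, h₃⟩ := ih h' (List.nodup_cons.2 ⟨fun hm => hn ((h n).2 hm), hl⟩)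
      refine ⟨h₁, fun k => ?_, h₃⟩
      rw [h₂]
      grind

theorem insertCodes_zero_nil_spec (t : List ℕ) :
    (∀ k, (insertCodes t 0 []).1.testBit k ↔ k ∈ (insertCodes t 0 []).2) ∧
    (∀ k, k ∈ (insertCodes t 0 []).2 ↔ k ∈ t) ∧ (insertCodes t 0 []).2.Nodup := by
  simpa using insertCodes_spec t (m := 0) (l := []) (by simp) (by simp)

theorem testBit_nextCodes {e : ℕ} {S : ℕ × List ℕ} (k : ℕ) :
    (nextCodes e S).1.testBit k ↔ k ∈ (nextCodes e S).2 :=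
  (insertCodes_zero_nil_spec _).1 k

theorem mem_nextCodes {e k : ℕ} {S : ℕ × List ℕ} :
    k ∈ (nextCodes e S).2 ↔ (∃ n ∈ S.2, k ∈ codeSteps e n) ∧ codeKept k = true := by
  rw [nextCodes, (insertCodes_zero_nil_spec _).2.1, List.mem_filter, List.mem_flatMap]

theorem testBit_wordCodes {w : List ℕ} (k : ℕ) :
    (wordCodes w).1.testBit k ↔ k ∈ (wordCodes w).2 := by
  cases w with
  | nil =>
    rw [wordCodes, Function.iterate_succ_apply']
    exact testBit_nextCodes k
  | cons e w => exact testBit_nextCodes k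

theorem nodup_balancedCodes (S : List ℕ) : (balancedCodes S).Nodup :=
  (insertCodes_zero_nil_spec _).2.2

theorem mem_balancedCodes {S : List ℕ} {c : ℕ} :
    c ∈ balancedCodes S ↔ ∃ n ∈ S, codeTotal n = 20 ∧ n % 10000 = c := by
  rw [balancedCodes, (insertCodes_zero_nil_spec _).2.1]
  simp [and_assoc]

theorem codeVec_mod (n : ℕ) : codeVec (n % 10000) = codeVec n := by
  simp only [codeVec, Prod.mk.injEq]
  omega

theorem codeVec_injOn : Set.InjOn codeVec {c | c < 10000} := by
  intro c hc c' hc' h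
  simp only [codeVec, Prod.mk.injEq, Set.mem_ofPred_eq] at *
  omega

/-- `CodesSound v S`: adding a code in `S` to `v` gives a vector with a signed expansion. -/
def CodesSound (v : Vec4) (S : List ℕ) : Prop :=
  ∀ n ∈ S, ∃ j, SignedVec j (v + codeVec n) (codeRun n)

/-- `CodesComplete v S y r`: the difference `y - v` with the signed run `r` is in `S`, or else
diverges. -/
def CodesComplete (v : Vec4) (S : List ℕ) (y : Vec4) (r : ℤ) : Prop :=
  (y - v).Diverges ∨ ∃ n ∈ S, codeVec n = y - v ∧ codeRun n = r

theorem CodesSound.next {v : Vec4} {S : ℕ × List ℕ} (h : CodesSound v S.2) {e : ℕ} (he : e ≤ 1) :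
    CodesSound (v.shift e) (nextCodes e S).2 := by
  intro n' hn'
  obtain ⟨⟨n, hn, hstep⟩, -⟩ := mem_nextCodes.1 hn'
  obtain ⟨j, hj⟩ := h n hn
  obtain ⟨m, hm, h₁, h₂⟩ := exists_signedDigit_of_mem_codeSteps he hstep
  refine ⟨j + 1, ?_⟩
  rw [h₁, h₂, Vec4.shift_add_shift, add_sub_cancel]
  exact hj.step hm

theorem CodesComplete.next {v y : Vec4} {r : ℤ} {S : ℕ × List ℕ} (h : CodesComplete v S.2 y r)
    (hS : ∀ n ∈ S.2, codeSmall n = true) {e : ℕ} (he : e ≤ 1) {m : ℤ × ℤ}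
    (hm : m ∈ signedDigits r) :
    CodesComplete (v.shift e) (nextCodes e S).2 (y.shift m.1) m.2 := by
  rw [CodesComplete, Vec4.shift_sub_shift]
  rcases h with h | ⟨n, hn, h₁, rfl⟩
  · have := signedDigits_bounds hm
    exact .inl (h.shift (by omega) (by omega))
  · obtain ⟨n', hn', h₂, h₃⟩ := exists_mem_codeSteps he (hS n hn) hm
    rw [h₁] at h₂
    by_cases hk : codeKept n' = true
    · exact .inr ⟨n', mem_nextCodes.2 ⟨⟨n, hn, hn'⟩, hk⟩, h₂, h₃⟩
    · rw [← h₂]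
      exact .inl (diverges_of_codeKept (by simpa using hk))

theorem codesSound_iterate (i : ℕ) : CodesSound 0 ((nextCodes 0)^[i] (0, [35555])).2 := by
  induction i with
  | zero =>
    intro n hn
    obtain rfl : n = 35555 := by simpa using hn
    exact ⟨0, SignedVec.zero⟩
  | succ i ih =>
    rw [Function.iterate_succ_apply']
    simpa [Vec4.zero_shift_zero] using! ih.next (Nat.zero_le 1)

theorem minimalWords_spec {w : List ℕ} (hw : w ∈ minimalWords) : cardCheck w = true ∧
    (∀ n ∈ (wordCodes w).2, codeSmall n = true) ∧ closedCheck w 0 = true ∧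
    ((wordShape w).run = 3 ∨ closedCheck w 1 = true) := by
  simpa [and_assoc] using List.all_eq_true.1 minimalWords_check w hw

theorem nil_mem_minimalWords : [] ∈ minimalWords := List.mem_cons_self

theorem SignedVec.codesComplete {k : ℕ} {y : Vec4} {r : ℤ} (h : SignedVec k y r) :
    CodesComplete 0 (wordCodes []).2 y r := by
  have check := wordCodes_zero_check
  simp only [Bool.and_eq_true, Nat.beq_eq, List.any_eq_true] at check
  obtain ⟨hmask, n, hn, rfl⟩ := check
  induction h with
  | zero => exact .inr ⟨35555, hn, rfl, rfl⟩
  | step _ hm ih =>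
    have := ih.next (minimalWords_spec nil_mem_minimalWords).2.1 (Nat.zero_le 1) hm
    rcases this with h | ⟨n, hn, h⟩
    · exact .inl (by simpa [Vec4.zero_shift_zero] using! h)
    · refine .inr ⟨n, ?_, by simpa [Vec4.zero_shift_zero] using! h⟩
      rw [← testBit_wordCodes, ← hmask, testBit_wordCodes]
      exact hn

theorem SignedVec.mono {k l : ℕ} {y : Vec4} {r : ℤ} (h : SignedVec k y r) (hkl : k ≤ l) :
    ∃ r', SignedVec l y r' := by
  obtain ⟨v, w, hv, hw, rfl⟩ := h.exists_prefixVec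
  obtain ⟨r', h', -⟩ := (hv.mono hkl).exists_signedVec (hw.mono hkl)
  exact ⟨r', h'⟩

/-- `BinaryRep k v L`: the vector `v` has an expansion of `k` binary digits, without four
consecutive ones, of shape `L`. -/
inductive BinaryRep : ℕ → Vec4 → Shape → Prop
  | zero : BinaryRep 0 0 .zero
  | step {k v L} {e : ℕ} : BinaryRep k v L → e ≤ 1 → (e = 1 → L.run < 3) →
      BinaryRep (k + 1) (v.shift e) (L.next e)

theorem Shape.run_next_zero (L : Shape) : (L.next 0).run = 0 := by
  cases L <;> simp only [Shape.next] <;> (try split_ifs) <;> simp [Shape.run]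

theorem Shape.run_next_one (L : Shape) : (L.next 1).run = L.run + 1 := by
  cases L <;> simp only [Shape.next] <;> (try split_ifs) <;> simp_all [Shape.run]

theorem Shape.isGeneric_next {L : Shape} {e : ℕ} (h : L.isGeneric = true) :
    (L.next e).isGeneric = true := by
  cases L with
  | generic r => cases e <;> rfl
  | _ => cases h

theorem PrefixVec.exists_rep {k a : ℕ} {v : Vec4} (h : PrefixVec k v a) :
    ∃ L : Shape, L.run = a ∧ BinaryRep k v L := by
  induction h with
  | zero => exact ⟨.zero, rfl, .zero⟩
  | first _ ih =>
    obtain ⟨L, -, h⟩ := ih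
    exact ⟨L.next 0, L.run_next_zero, by simpa using h.step (e := 0) (by simp) (by simp)⟩
  | second _ ha ih =>
    obtain ⟨L, rfl, h⟩ := ih
    exact ⟨L.next 1, L.run_next_one, by simpa using h.step (e := 1) (by simp) (by simpa using ha)⟩

theorem exists_rep (n : ℕ) : ∃ k v L, BinaryRep k v L ∧ v.total = n := by
  have hn := lt_length_mbIter n
  have h : mbIter 4 n = (mbIter 4 n).take n ++ (mbIter 4 n)[n] :: (mbIter 4 n).drop (n + 1) := by
    simp
  obtain ⟨L, -, hL⟩ := (prefixVec_of_mbIter h).exists_rep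
  refine ⟨n, _, L, hL, ?_⟩
  rw [total_parikh fun a ha => mbIter_lt (List.mem_of_mem_take ha), List.length_take,
    min_eq_left hn.le]

theorem BinaryRep.exists_minimalWord {k : ℕ} {v : Vec4} {L : Shape} (h : BinaryRep k v L) :
    ∃ w ∈ minimalWords, wordShape w = L ∧ CodesSound v (wordCodes w).2 ∧
      (L.isGeneric = false →
        ∀ j y r, SignedVec (j + k) y r → CodesComplete v (wordCodes w).2 y r) := by
  induction h with
  | zero =>
    exact ⟨[], nil_mem_minimalWords, rfl, codesSound_iterate 6, fun _ _ _ _ h => h.codesComplete⟩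
  | @step k v L e _ he hrun ih =>
    obtain ⟨w, hw, rfl, hsound, hcomplete⟩ := ih
    obtain ⟨-, hsmall, h₀, h₁⟩ := minimalWords_spec hw
    have hclosed : closedCheck w e = true := by
      interval_cases e
      · exact h₀
      · exact h₁.resolve_left (hrun rfl).ne
    simp only [closedCheck, List.any_eq_true, Bool.and_eq_true, decide_eq_true_eq, Nat.beq_eq,
      Bool.or_eq_true] at hclosed
    obtain ⟨u, hu, ⟨hshape, hsub⟩, heq⟩ := hclosed
    refine ⟨u, hu, hshape, fun n hn => hsound.next he n ?_, fun hgen j y r hy => ?_⟩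
    · rw [← testBit_wordCodes, ← hsub, Nat.testBit_and, Bool.and_eq_true] at hn
      exact (testBit_wordCodes (w := e :: w) n).1 hn.2
    · replace heq := heq.resolve_left (by rw [hshape, hgen]; simp)
      have hgen' : (wordShape w).isGeneric = false := by
        by_contra hc
        rw [Shape.isGeneric_next (by simpa using hc)] at hgen
        cases hgen
      cases hy with
      | step hy hm =>
        rcases (hcomplete hgen' j _ _ hy).next hsmall he hm with h | ⟨n, hn, h⟩
        · exact .inl h
        · refine .inr ⟨n, ?_, h⟩
          rw [← testBit_wordCodes, heq, testBit_wordCodes]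
          exact hn

theorem image_balancedCodes_subset {v : Vec4} {n : ℕ} (hv : v.total = n) {S : List ℕ}
    (h : CodesSound v S) :
    (fun c => v + codeVec c) '' {c | c ∈ balancedCodes S} ⊆ signedVecs n := by
  rintro _ ⟨c, hc, rfl⟩
  obtain ⟨m, hm, ht, rfl⟩ := mem_balancedCodes.1 hc
  obtain ⟨j, hj⟩ := h m hm
  refine ⟨?_, j, _, by simpa only [codeVec_mod] using hj⟩
  simp only [codeVec_mod, Vec4.total_add, total_codeVec, hv, ht]
  simp

theorem ncard_image_balancedCodes (v : Vec4) (S : List ℕ) :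
    ((fun c => v + codeVec c) '' {c | c ∈ balancedCodes S}).ncard = (balancedCodes S).length := by
  rw [Set.InjOn.ncard_image, ← List.coe_toFinset, Set.ncard_coe_finset,
    List.toFinset_card_of_nodup (nodup_balancedCodes S)]
  intro c hc c' hc' h
  refine codeVec_injOn ?_ ?_ (add_left_cancel h)
  · obtain ⟨m, -, -, rfl⟩ := mem_balancedCodes.1 hc
    exact Nat.mod_lt m (by simp)
  · obtain ⟨m, -, -, rfl⟩ := mem_balancedCodes.1 hc'
    exact Nat.mod_lt m (by simp)

theorem BinaryRep.mbAC_eq_six_iff {k n : ℕ} {v : Vec4} {L : Shape} (h : BinaryRep k v L)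
    (hv : v.total = n) :
    mbAC 4 n = 6 ↔ L.isDouble = true := by
  obtain ⟨w, hw, rfl, hsound, hcomplete⟩ := h.exists_minimalWord
  have hcard := (minimalWords_spec hw).1
  have hsub := image_balancedCodes_subset hv hsound
  rw [cardCheck, Bool.cond_eq_ite] at hcard
  rw [mbAC_eq_ncard_signedVecs]
  split_ifs at hcard with hgen
  · have hdouble : (wordShape w).isDouble = false := by
      cases hs : wordShape w <;> simp_all [Shape.isGeneric, Shape.isDouble]
    rw [hdouble]
    refine iff_of_false (fun h₆ => ?_) (by simp)
    have := Set.ncard_le_ncard hsub (Set.finite_of_ncard_ne_zero (by omega))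
    rw [ncard_image_balancedCodes] at this
    have := Nat.le_of_ble_eq_true hcard
    omega
  · have heq : signedVecs n =
        (fun c => v + codeVec c) '' {c | c ∈ balancedCodes (wordCodes w).2} := by
      refine subset_antisymm ?_ hsub
      rintro y ⟨hy, j, r, hr⟩
      obtain ⟨r', hr'⟩ := hr.mono (Nat.le_add_right j k)
      have htotal : (y - v).total = 0 := by rw [Vec4.total_sub, hy, hv, sub_self]
      rcases hcomplete (by simpa using hgen) j y r' hr' with hd | ⟨m, hm, hvec, -⟩
      · exact absurd htotal hd.total_ne_zero
      · refine ⟨m % 10000, mem_balancedCodes.2 ⟨m, hm, ?_, rfl⟩, ?_⟩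
        · rw [← hvec, total_codeVec] at htotal
          omega
        · simp [codeVec_mod, hvec]
    rw [heq, ncard_image_balancedCodes, ← Nat.beq_eq, beq_iff_eq.1 hcard]

theorem BinaryRep.eq_of_shape {k : ℕ} {v : Vec4} {L : Shape} (h : BinaryRep k v L) :
    (L = .zero → v = 0) ∧
    (∀ p, L = .single p → v = (fun x : Vec4 => x.shift 0)^[p] (1, 0, 0, 0)) ∧
    (∀ p, L = .double p → p ≤ 2 ∧ v = (fun x : Vec4 => x.shift 0)^[p] (2, 1, 0, 0)) := by
  induction h with
  | zero => simp
  | @step k v L e _ he _ ih =>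
    obtain ⟨hzero, hsingle, hdouble⟩ := ih
    interval_cases e
    · cases L <;> simp only [Shape.next] <;> (try split_ifs) <;>
        simp_all [Function.iterate_succ_apply', Vec4.zero_shift_zero]
    · cases L <;> simp only [Shape.next] <;> (try split_ifs) <;>
        simp_all [Vec4.shift, Vec4.total]

theorem mbAC_four_eq_six_iff (n : ℕ) : mbAC 4 n = 6 ↔ n = 3 ∨ n = 6 ∨ n = 12 := by
  constructor
  · intro h
    obtain ⟨k, v, L, hL, hv⟩ := exists_rep n
    have hdouble := (hL.mbAC_eq_six_iff hv).1 h
    cases L with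
    | double p =>
      obtain ⟨hp, rfl⟩ := hL.eq_of_shape.2.2 p rfl
      interval_cases p <;> simp [Vec4.shift, Vec4.total] at hv <;> omega
    | _ => cases hdouble
  · have h₂ : BinaryRep 2 (2, 1, 0, 0) (.double 0) :=
      (BinaryRep.zero.step (e := 1) le_rfl (by decide)).step (e := 1) le_rfl (by decide)
    have h₃ : BinaryRep 3 (3, 2, 1, 0) (.double 1) := h₂.step (e := 0) (by simp) (by simp)
    have h₄ : BinaryRep 4 (6, 3, 2, 1) (.double 2) := h₃.step (e := 0) (by simp) (by simp)
    rintro (rfl | rfl | rfl)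
    · exact (h₂.mbAC_eq_six_iff rfl).2 rfl
    · exact (h₃.mbAC_eq_six_iff rfl).2 rfl
    · exact (h₄.mbAC_eq_six_iff rfl).2 rfl

theorem fourbonacci_abelian_complexity_eq_six_iff :
    (∀ n : ℕ, 1 ≤ n → (mbAC 4 n = 6 ↔ n = 3 ∨ n = 6 ∨ n = 12)) ∧
    {n : ℕ | 1 ≤ n ∧ mbAC 4 n = 6}.Finite := by
  refine ⟨fun n _ => mbAC_four_eq_six_iff n, Set.Finite.subset (s := {3, 6, 12}) (by simp) ?_⟩
  rintro n ⟨-, hn⟩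
  simpa using (mbAC_four_eq_six_iff n).1 hn
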